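/- arXiv:2308.00360 — 7 statements merged into one kernel-verified Lean document; each statement's English description precedes it below -/
import Mathlib

section
/- There exists an optimal solution x* of the continuous relaxation problem (minimize f over the relaxation feasible set) such that ‖x*‖₀ = n, i.e., x* has exactly n nonzero entries; moreover, this x* is feasible for the CPD integer problem and is an optimal solution of the CPD integer problem. -/
open Finset Filter

noncomputable section

/-- The QSAP objective `f(x) = (1/2) xᵀBx + aᵀx` written blockwise. -/
def qsapF {n : ℕ} {l : Fin n → ℕ}
    (a : (i : Fin n) → Fin (l i) → ℝ)
    (B : (i : Fin n) → (j : Fin n) → Matrix (Fin (l i)) (Fin (l j)) ℝ)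
    (x : (i : Fin n) → Fin (l i) → ℝ) : ℝ :=
  (1 / 2) * (∑ i, ∑ j, ∑ r, ∑ s, B i j r s * x i r * x j s)
    + ∑ i, ∑ r, a i r * x i r

/-- Feasibility for the continuous relaxation: each block sums to one, entries nonnegative. -/
def RelaxFeas {n : ℕ} {l : Fin n → ℕ} (x : (i : Fin n) → Fin (l i) → ℝ) : Prop :=
  (∀ i, ∑ r, x i r = 1) ∧ ∀ i r, 0 ≤ x i r

/-- Feasibility for the CPD integer problem: each block sums to one, entries in {0,1}. -/
def IntFeas {n : ℕ} {l : Fin n → ℕ} (x : (i : Fin n) → Fin (l i) → ℝ) : Prop :=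
  (∀ i, ∑ r, x i r = 1) ∧ ∀ i r, x i r = 0 ∨ x i r = 1

/-- Global minimizer of the continuous relaxation. -/
def IsRelaxMin {n : ℕ} {l : Fin n → ℕ}
    (a : (i : Fin n) → Fin (l i) → ℝ)
    (B : (i : Fin n) → (j : Fin n) → Matrix (Fin (l i)) (Fin (l j)) ℝ)
    (x : (i : Fin n) → Fin (l i) → ℝ) : Prop :=
  RelaxFeas x ∧ ∀ y, RelaxFeas y → qsapF a B x ≤ qsapF a B y

/-- Global minimizer of the CPD integer problem. -/
def IsIntMin {n : ℕ} {l : Fin n → ℕ}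
    (a : (i : Fin n) → Fin (l i) → ℝ)
    (B : (i : Fin n) → (j : Fin n) → Matrix (Fin (l i)) (Fin (l j)) ℝ)
    (x : (i : Fin n) → Fin (l i) → ℝ) : Prop :=
  IntFeas x ∧ ∀ y, IntFeas y → qsapF a B x ≤ qsapF a B y

/-- `‖x‖₀`, the number of nonzero entries of `x`. -/
def norm0 {n : ℕ} {l : Fin n → ℕ} (x : (i : Fin n) → Fin (l i) → ℝ) : ℕ :=
  Set.ncard {p : Σ i : Fin n, Fin (l i) | x p.1 p.2 ≠ 0}

/-- The support `Γ(x) = {(i,r) : x^{(i)}_r > 0}`. -/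
def supp {n : ℕ} {l : Fin n → ℕ} (x : (i : Fin n) → Fin (l i) → ℝ) :
    Set (Σ i : Fin n, Fin (l i)) :=
  {p | 0 < x p.1 p.2}

/-- The per-block argmax set `J_i(x) = argmax_r x^{(i)}_r`. -/
def Jblock {n : ℕ} {l : Fin n → ℕ} (x : (i : Fin n) → Fin (l i) → ℝ) (i : Fin n) :
    Set (Fin (l i)) :=
  {r | ∀ r', x i r' ≤ x i r}

/-- The combined argmax set `J(x) = ∪_i {i} × J_i(x)`. -/
def Jset {n : ℕ} {l : Fin n → ℕ} (x : (i : Fin n) → Fin (l i) → ℝ) :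
    Set (Σ i : Fin n, Fin (l i)) :=
  {p | ∀ r', x p.1 r' ≤ x p.1 p.2}


theorem avg_update {n : ℕ} {l : Fin n → ℕ}
    (y : (i : Fin n) → Fin (l i) → ℝ) (i : Fin n) (hs : ∑ r, y i r = 1)
    (j : Fin n) (s : Fin (l j)) :
    ∑ r, y i r * Function.update y i (Pi.single r (1:ℝ)) j s = y j s := by
  by_cases h : j = i
  · subst h
    simp [Pi.single_apply]
  · simp [Function.update_of_ne h, ← Finset.sum_mul, hs]

theorem qsapF_avg {n : ℕ} {l : Fin n → ℕ}
    (a : (i : Fin n) → Fin (l i) → ℝ)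
    (B : (i : Fin n) → (j : Fin n) → Matrix (Fin (l i)) (Fin (l j)) ℝ)
    (hdiag : ∀ i, B i i = 0)
    (y : (i : Fin n) → Fin (l i) → ℝ) (i : Fin n) (hs : ∑ r, y i r = 1) :
    ∑ r, y i r * qsapF a B (Function.update y i (Pi.single r (1:ℝ))) = qsapF a B y := by
  have h2 : ∀ j k s t, ∑ r, y i r * (B j k s t * Function.update y i (Pi.single r (1:ℝ)) j s
      * Function.update y i (Pi.single r (1:ℝ)) k t) = B j k s t * y j s * y k t := by
    intro j k s t
    by_cases hj : j = i
    · by_cases hk : k = i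
      · subst hj; subst hk; simp [hdiag]
      · rw [← avg_update y i hs j s, Finset.mul_sum, Finset.sum_mul]
        refine Finset.sum_congr rfl fun r _ => ?_
        rw [Function.update_of_ne hk]; ring
    · rw [← avg_update y i hs k t, Finset.mul_sum]
      refine Finset.sum_congr rfl fun r _ => ?_
      rw [Function.update_of_ne hj]; ring
  have h1 : ∀ j s, ∑ r, y i r * (a j s * Function.update y i (Pi.single r (1:ℝ)) j s)
      = a j s * y j s := by
    intro j s
    conv_rhs => rw [← avg_update y i hs j s, Finset.mul_sum]
    exact Finset.sum_congr rfl fun r _ => by ring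
  unfold qsapF
  simp_rw [mul_add, Finset.sum_add_distrib]
  congr 1
  · simp_rw [mul_left_comm (y i _) (1/2 : ℝ) _]
    rw [← Finset.mul_sum]
    congr 1
    simp_rw [Finset.mul_sum]
    rw [Finset.sum_comm]; refine Finset.sum_congr rfl fun j _ => ?_
    rw [Finset.sum_comm]; refine Finset.sum_congr rfl fun k _ => ?_
    rw [Finset.sum_comm]; refine Finset.sum_congr rfl fun s _ => ?_
    rw [Finset.sum_comm]; exact Finset.sum_congr rfl fun t _ => h2 j k s t
  · simp_rw [Finset.mul_sum]
    rw [Finset.sum_comm]; refine Finset.sum_congr rfl fun j _ => ?_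
    rw [Finset.sum_comm]; exact Finset.sum_congr rfl fun s _ => h1 j s

theorem qsap_round_block {n : ℕ} {l : Fin n → ℕ}
    (a : (i : Fin n) → Fin (l i) → ℝ)
    (B : (i : Fin n) → (j : Fin n) → Matrix (Fin (l i)) (Fin (l j)) ℝ)
    (hdiag : ∀ i, B i i = 0)
    (y : (i : Fin n) → Fin (l i) → ℝ) (hy : RelaxFeas y) (i : Fin n) :
    ∃ r, qsapF a B (Function.update y i (Pi.single r (1:ℝ))) ≤ qsapF a B y := by
  by_contra! h
  have e := qsapF_avg a B hdiag y i (hy.1 i)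
  have hpos : ∃ r, 0 < y i r := by
    by_contra! h0
    have := Finset.sum_nonpos (s := Finset.univ) (fun r _ => h0 r)
    rw [hy.1 i] at this
    linarith
  obtain ⟨r0, hr0⟩ := hpos
  have lt : ∑ r, y i r * qsapF a B y
      < ∑ r, y i r * qsapF a B (Function.update y i (Pi.single r (1:ℝ))) :=
    Finset.sum_lt_sum (fun r _ => mul_le_mul_of_nonneg_left (h r).le (hy.2 i r))
      ⟨r0, Finset.mem_univ _, mul_lt_mul_of_pos_left (h r0) hr0⟩
  rw [e, ← Finset.sum_mul, hy.1 i, one_mul] at lt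
  exact lt_irrefl _ lt

theorem round_all {n : ℕ} {l : Fin n → ℕ}
    (a : (i : Fin n) → Fin (l i) → ℝ)
    (B : (i : Fin n) → (j : Fin n) → Matrix (Fin (l i)) (Fin (l j)) ℝ)
    (hdiag : ∀ i, B i i = 0)
    (y : (i : Fin n) → Fin (l i) → ℝ) (hy : RelaxFeas y) (S : Finset (Fin n)) :
    ∃ z, RelaxFeas z ∧ qsapF a B z ≤ qsapF a B y ∧
      ∀ i ∈ S, ∃ r, z i = Pi.single r (1:ℝ) := by
  induction S using Finset.induction_on with
  | empty => exact ⟨y, hy, le_rfl, by simp⟩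
  | insert i S _ ih =>
    obtain ⟨z, hz, hle, hS⟩ := ih
    obtain ⟨r, hr⟩ := qsap_round_block a B hdiag z hz i
    refine ⟨Function.update z i (Pi.single r (1:ℝ)), ⟨fun j => ?_, fun j s => ?_⟩,
      hr.trans hle, fun j hj => ?_⟩
    · by_cases h : j = i
      · subst h; simp
      · rw [Function.update_of_ne h]; exact hz.1 j
    · by_cases h : j = i
      · subst h
        simp only [Function.update_self, Pi.single_apply]
        split_ifs <;> norm_num
      · rw [Function.update_of_ne h]; exact hz.2 j s
    · by_cases h : j = i
      · subst h; exact ⟨r, by simp⟩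
      · rw [Function.update_of_ne h]
        exact hS j ((Finset.mem_insert.1 hj).resolve_left h)

/-- there is an optimal solution `x*` of the continuous relaxation
with exactly `n` nonzero entries, and this `x*` is feasible for, and optimal
for, the CPD integer problem. -/
theorem stmt1 {n : ℕ} {l : Fin n → ℕ} (hn : 1 ≤ n) (hl : ∀ i, 1 ≤ l i)
    (a : (i : Fin n) → Fin (l i) → ℝ)
    (B : (i : Fin n) → (j : Fin n) → Matrix (Fin (l i)) (Fin (l j)) ℝ)
    (hsym : ∀ i j r s, B i j r s = B j i s r)
    (hdiag : ∀ i, B i i = 0) :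
    ∃ x : (i : Fin n) → Fin (l i) → ℝ,
      IsRelaxMin a B x ∧ norm0 x = n ∧ IntFeas x ∧ IsIntMin a B x := by
  have : ∀ i, Nonempty (Fin (l i)) := fun i => ⟨⟨0, hl i⟩⟩
  let v : ((i : Fin n) → Fin (l i)) → (i : Fin n) → Fin (l i) → ℝ :=
    fun σ i => Pi.single (σ i) (1:ℝ)
  obtain ⟨σ, hσ⟩ := Finite.exists_min (fun σ => qsapF a B (v σ))
  have hI : IntFeas (v σ) := by
    refine ⟨fun i => by simp [v], fun i r => ?_⟩
    simp only [v, Pi.single_apply]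
    split_ifs <;> simp
  have hIR : ∀ x : (i : Fin n) → Fin (l i) → ℝ, IntFeas x → RelaxFeas x := by
    intro x hx
    refine ⟨hx.1, fun i r => ?_⟩
    rcases hx.2 i r with h | h <;> rw [h]
    exact zero_le_one
  have hmin : ∀ y, RelaxFeas y → qsapF a B (v σ) ≤ qsapF a B y := by
    intro y hy
    obtain ⟨z, hz, hle, hS⟩ := round_all a B hdiag y hy Finset.univ
    choose τ hτ using fun i => hS i (Finset.mem_univ i)
    have : z = v τ := funext hτ
    rw [this] at hle
    exact (hσ τ).trans hle
  refine ⟨v σ, ⟨hIR _ hI, hmin⟩, ?_, hI, hI, fun y hy => hmin y (hIR y hy)⟩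
  have hset : {p : Σ i : Fin n, Fin (l i) | v σ p.1 p.2 ≠ 0}
      = Set.range (fun i => (⟨i, σ i⟩ : Σ i : Fin n, Fin (l i))) := by
    ext ⟨i, r⟩
    simp only [v, Set.mem_setOf_eq, Set.mem_range, Pi.single_apply]
    constructor
    · intro h
      have : r = σ i := by
        by_contra hne
        simp [hne] at h
      exact ⟨i, by rw [this]⟩
    · rintro ⟨j, hj⟩
      cases hj
      simp
  unfold norm0
  rw [hset, ← Set.image_univ, Set.ncard_image_of_injective _ (fun i j h => congrArg Sigma.fst h),
    Set.ncard_univ, Nat.card_eq_fintype_card, Fintype.card_fin]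
end
end

section
/- The optimal value of the continuous relaxation problem equals the optimal value of the CPD integer problem: the minimum of f over the relaxation feasible set {x ≥ 0 : Σ_r x^{(i)}_r = 1 for each i} equals the minimum of f over the integer feasible set {x ∈ {0,1}^m : Σ_r x^{(i)}_r = 1 for each i}. -/
open Finset Filter

noncomputable section

/-- Affine on the simplex hyperplane: values are averages of the vertex values. -/
def AffS {k : ℕ} (T : (Fin k → ℝ) → ℝ) : Prop :=
  ∀ y : Fin k → ℝ, ∑ r, y r = 1 → T y = ∑ r, y r * T (Pi.single r 1)

lemma AffS.const {k : ℕ} (c : ℝ) : AffS (k := k) (fun _ => c) := by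
  intro y hy
  rw [← Finset.sum_mul, hy, one_mul]

lemma AffS.coord {k : ℕ} (r : Fin k) : AffS (fun y => y r) := by
  intro y hy
  simp [Pi.single_apply]

lemma AffS.cmul {k : ℕ} (c : ℝ) {T : (Fin k → ℝ) → ℝ} (h : AffS T) :
    AffS (fun y => c * T y) := by
  intro y hy
  simp only [h y hy, Finset.mul_sum]
  exact Finset.sum_congr rfl fun r _ => by ring

lemma AffS.add {k : ℕ} {T U : (Fin k → ℝ) → ℝ} (h : AffS T) (h' : AffS U) :
    AffS (fun y => T y + U y) := by
  intro y hy
  simp only [h y hy, h' y hy, mul_add, Finset.sum_add_distrib]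

lemma AffS.sum {k : ℕ} {ι : Type} (s : Finset ι) {T : ι → (Fin k → ℝ) → ℝ}
    (h : ∀ i, AffS (T i)) : AffS (fun y => ∑ i ∈ s, T i y) := by
  intro y hy
  simp only [Finset.mul_sum]
  rw [Finset.sum_comm]
  exact Finset.sum_congr rfl fun i _ => h i y hy

lemma affS_upd {n : ℕ} {l : Fin n → ℕ} (x : (i : Fin n) → Fin (l i) → ℝ) (i j : Fin n)
    (r : Fin (l j)) : AffS (fun y => Function.update x i y j r) := by
  by_cases h : j = i
  · subst h
    simpa using AffS.coord r
  · simpa [Function.update_of_ne h] using AffS.const (x j r)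

lemma affS_qsapF {n : ℕ} {l : Fin n → ℕ}
    (a : (i : Fin n) → Fin (l i) → ℝ)
    (B : (i : Fin n) → (j : Fin n) → Matrix (Fin (l i)) (Fin (l j)) ℝ)
    (hdiag : ∀ i, B i i = 0) (x : (i : Fin n) → Fin (l i) → ℝ) (i : Fin n) :
    AffS (fun y => qsapF a B (Function.update x i y)) := by
  unfold qsapF
  refine AffS.add (AffS.cmul _ (AffS.sum _ fun p => AffS.sum _ fun q => AffS.sum _ fun r =>
    AffS.sum _ fun s => ?_)) (AffS.sum _ fun p => AffS.sum _ fun r => AffS.cmul _ (affS_upd x i p r))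
  by_cases hq : q = i
  · by_cases hp : p = i
    · subst hp
      subst hq
      simpa [hdiag] using AffS.const 0
    · simpa only [Function.update_of_ne hp] using AffS.cmul (B p q r s * x p r) (affS_upd x i q s)
  · have := AffS.cmul (B p q r s * x q s) (affS_upd x i p r)
    simp only [Function.update_of_ne hq]
    convert this using 2
    ring

lemma exists_vertex {k : ℕ} {T : (Fin k → ℝ) → ℝ} (h : AffS T) (y : Fin k → ℝ)
    (hy : ∑ r, y r = 1) (h0 : ∀ r, 0 ≤ y r) : ∃ r, T (Pi.single r 1) ≤ T y := by
  by_contra hc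
  push Not at hc
  have h1 : ∑ r, y r * T y ≤ ∑ r, y r * T (Pi.single r 1) :=
    Finset.sum_le_sum fun r _ => mul_le_mul_of_nonneg_left (hc r).le (h0 r)
  obtain ⟨r, -, hr⟩ : ∃ r ∈ Finset.univ, 0 < y r := by
    apply Finset.exists_lt_of_sum_lt
    simp [hy]
  have h2 : ∑ r, y r * T y < ∑ r, y r * T (Pi.single r 1) :=
    Finset.sum_lt_sum (fun r _ => mul_le_mul_of_nonneg_left (hc r).le (h0 r))
      ⟨r, Finset.mem_univ r, mul_lt_mul_of_pos_left (hc r) hr⟩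
  rw [← Finset.sum_mul, hy, one_mul, ← h y hy] at h2
  exact lt_irrefl _ h2

lemma round_blocks {n : ℕ} {l : Fin n → ℕ}
    (a : (i : Fin n) → Fin (l i) → ℝ)
    (B : (i : Fin n) → (j : Fin n) → Matrix (Fin (l i)) (Fin (l j)) ℝ)
    (hdiag : ∀ i, B i i = 0) (x : (i : Fin n) → Fin (l i) → ℝ) (hx : RelaxFeas x)
    (S : Finset (Fin n)) :
    ∃ y, RelaxFeas y ∧ qsapF a B y ≤ qsapF a B x ∧ ∀ i ∈ S, ∃ r, y i = Pi.single r 1 := by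
  induction S using Finset.induction_on with
  | empty => exact ⟨x, hx, le_rfl, by simp⟩
  | insert i S hi ih =>
    obtain ⟨y, hy, hle, hS⟩ := ih
    obtain ⟨r, hr⟩ := exists_vertex (affS_qsapF a B hdiag y i) (y i) (hy.1 i) (hy.2 i)
    simp only [Function.update_eq_self] at hr
    refine ⟨Function.update y i (Pi.single r 1), ⟨fun j => ?_, fun j => ?_⟩, hr.trans hle,
      fun j hj => ?_⟩
    · by_cases h : j = i
      · subst h
        simp
      · simpa [Function.update_of_ne h] using hy.1 j
    · by_cases h : j = i
      · subst h
        intro s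
        simp only [Function.update_self, Pi.single_apply]
        split_ifs <;> norm_num
      · simpa [Function.update_of_ne h] using hy.2 j
    · by_cases h : j = i
      · subst h
        exact ⟨r, by simp⟩
      · simpa [Function.update_of_ne h] using hS j ((Finset.mem_insert.1 hj).resolve_left h)

/-- the minimum of `f` over the relaxation feasible set equals the
minimum of `f` over the integer feasible set (both minima are attained). -/
theorem stmt2 {n : ℕ} {l : Fin n → ℕ} (hn : 1 ≤ n) (hl : ∀ i, 1 ≤ l i)
    (a : (i : Fin n) → Fin (l i) → ℝ)
    (B : (i : Fin n) → (j : Fin n) → Matrix (Fin (l i)) (Fin (l j)) ℝ)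
    (hsym : ∀ i j r s, B i j r s = B j i s r)
    (hdiag : ∀ i, B i i = 0) :
    ∃ v : ℝ,
      IsLeast (qsapF a B '' {x | RelaxFeas x}) v ∧
      IsLeast (qsapF a B '' {x | IntFeas x}) v := by
  haveI : ∀ i, Nonempty (Fin (l i)) := fun i => ⟨⟨0, hl i⟩⟩
  let e : ((i : Fin n) → Fin (l i)) → (i : Fin n) → Fin (l i) → ℝ := fun σ i => Pi.single (σ i) 1
  obtain ⟨σ, hσ⟩ := Finite.exists_min (fun σ => qsapF a B (e σ))
  have hint : ∀ x : (i : Fin n) → Fin (l i) → ℝ, IntFeas x → RelaxFeas x := fun x hx =>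
    ⟨hx.1, fun i r => by rcases hx.2 i r with h | h <;> rw [h] <;> norm_num⟩
  have he : IntFeas (e σ) := by
    refine ⟨fun i => by simp [e], fun i r => ?_⟩
    simp only [e, Pi.single_apply]
    split_ifs <;> simp
  have hmin : ∀ x, RelaxFeas x → qsapF a B (e σ) ≤ qsapF a B x := by
    intro x hx
    obtain ⟨y, -, hle, hv⟩ := round_blocks a B hdiag x hx Finset.univ
    choose τ hτ using fun i => hv i (Finset.mem_univ i)
    have : y = e τ := funext hτ
    rw [this] at hle
    exact (hσ τ).trans hle
  refine ⟨qsapF a B (e σ), ⟨⟨e σ, hint _ he, rfl⟩, ?_⟩, ⟨⟨e σ, he, rfl⟩, ?_⟩⟩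
  · rintro _ ⟨x, hx, rfl⟩
    exact hmin x hx
  · rintro _ ⟨x, hx, rfl⟩
    exact hmin x (hint x hx)

end
end

section
/- Let x̄ be a global minimizer of the continuous relaxation problem, let j be a block index, and let s be any index with x̄^{(j)}_s > 0. Then the point x̂ obtained from x̄ by replacing the block x̄^{(j)} with the standard unit vector e_s ∈ ℝ^{l_j} (i.e., x̂^{(j)}_s = 1, x̂^{(j)}_r = 0 for r ≠ s, and x̂^{(i)} = x̄^{(i)} for i ≠ j) satisfies f(x̂) = f(x̄), and hence x̂ is also a global minimizer of the continuous relaxation problem. -/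
open Finset Filter

noncomputable section

theorem qsapF_update_aux {n : ℕ} {l : Fin n → ℕ}
    (a : (i : Fin n) → Fin (l i) → ℝ)
    (B : (i : Fin n) → (j : Fin n) → Matrix (Fin (l i)) (Fin (l j)) ℝ)
    (hdiag : ∀ i, B i i = 0)
    (x : (i : Fin n) → Fin (l i) → ℝ) (j : Fin n) :
    ∃ (C : ℝ) (c : Fin (l j) → ℝ), ∀ v : Fin (l j) → ℝ,
      qsapF a B (Function.update x j v) = C + ∑ r, c r * v r := by
  refine ⟨(1 / 2) * (∑ i ∈ univ.erase j, ∑ k ∈ univ.erase j, ∑ r, ∑ s,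
      B i k r s * x i r * x k s) + ∑ i ∈ univ.erase j, ∑ r, a i r * x i r,
    fun r => (1 / 2) * ((∑ k ∈ univ.erase j, ∑ s, B j k r s * x k s)
      + ∑ i ∈ univ.erase j, ∑ s, B i j s r * x i s) + a j r, fun v => ?_⟩
  have split : ∀ g : Fin n → ℝ, ∑ i, g i = g j + ∑ i ∈ univ.erase j, g i :=
    fun g => (Finset.add_sum_erase univ g (mem_univ j)).symm
  have e : ∀ i ∈ univ.erase j, Function.update x j v i = x i := fun i hi =>
    Function.update_of_ne (ne_of_mem_erase hi) v x
  have h1 : ∑ k ∈ univ.erase j, ∑ r, ∑ s, B j k r s * v r * Function.update x j v k s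
      = ∑ r, (∑ k ∈ univ.erase j, ∑ s, B j k r s * x k s) * v r := by
    simp_rw [Finset.sum_mul]
    rw [Finset.sum_comm]
    refine sum_congr rfl fun r _ => sum_congr rfl fun k hk => sum_congr rfl fun s _ => ?_
    rw [e k hk]; ring
  have h2 : ∑ i ∈ univ.erase j, ∑ r, ∑ s, B i j r s * Function.update x j v i r * v s
      = ∑ r, (∑ i ∈ univ.erase j, ∑ s, B i j s r * x i s) * v r := by
    simp_rw [Finset.sum_mul]
    rw [Finset.sum_comm]
    refine sum_congr rfl fun i hi => ?_
    rw [Finset.sum_comm]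
    refine sum_congr rfl fun r _ => sum_congr rfl fun s _ => ?_
    rw [e i hi]
  have h3 : ∑ i ∈ univ.erase j, ∑ k ∈ univ.erase j, ∑ r, ∑ s,
      B i k r s * Function.update x j v i r * Function.update x j v k s
      = ∑ i ∈ univ.erase j, ∑ k ∈ univ.erase j, ∑ r, ∑ s, B i k r s * x i r * x k s := by
    refine sum_congr rfl fun i hi => sum_congr rfl fun k hk => ?_
    rw [e i hi, e k hk]
  have h4 : ∑ i ∈ univ.erase j, ∑ r, a i r * Function.update x j v i r
      = ∑ i ∈ univ.erase j, ∑ r, a i r * x i r := by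
    refine sum_congr rfl fun i hi => ?_
    rw [e i hi]
  have h5 : ∀ i, ∑ k, ∑ r, ∑ s,
      B i k r s * Function.update x j v i r * Function.update x j v k s
      = (∑ r, ∑ s, B i j r s * Function.update x j v i r * v s)
      + ∑ k ∈ univ.erase j, ∑ r, ∑ s,
      B i k r s * Function.update x j v i r * Function.update x j v k s := by
    intro i
    rw [split]
    simp only [Function.update_self]
  unfold qsapF
  simp_rw [h5]
  rw [split, split (fun i => ∑ r, a i r * Function.update x j v i r), sum_add_distrib, h3, h4, h2]
  simp only [Function.update_self]
  rw [h1]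
  simp only [hdiag, Matrix.zero_apply, zero_mul, sum_const_zero, add_mul, mul_add, mul_assoc,
    sum_add_distrib, ← mul_sum]
  ring

/-- replacing one block of a global minimizer `x̄` of the relaxation
by the unit vector `e_s` where `x̄^{(j)}_s > 0` keeps the objective value, hence
produces another global minimizer of the relaxation. -/
theorem stmt3 {n : ℕ} {l : Fin n → ℕ} (hn : 1 ≤ n) (hl : ∀ i, 1 ≤ l i)
    (a : (i : Fin n) → Fin (l i) → ℝ)
    (B : (i : Fin n) → (j : Fin n) → Matrix (Fin (l i)) (Fin (l j)) ℝ)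
    (hsym : ∀ i j r s, B i j r s = B j i s r)
    (hdiag : ∀ i, B i i = 0)
    (xbar : (i : Fin n) → Fin (l i) → ℝ) (hxbar : IsRelaxMin a B xbar)
    (j : Fin n) (s : Fin (l j)) (hs : 0 < xbar j s) :
    let xhat : (i : Fin n) → Fin (l i) → ℝ :=
      Function.update xbar j (fun r => if r = s then 1 else 0)
    qsapF a B xhat = qsapF a B xbar ∧ IsRelaxMin a B xhat := by
  intro xhat
  obtain ⟨⟨hsum, hnn⟩, hmin⟩ := hxbar
  obtain ⟨C, c, hc⟩ := qsapF_update_aux a B hdiag xbar j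
  have feas : ∀ v : Fin (l j) → ℝ, ∑ r, v r = 1 → (∀ r, 0 ≤ v r) →
      RelaxFeas (Function.update xbar j v) := by
    intro v h1 h2
    constructor
    · intro i
      by_cases h : i = j
      · subst h; simpa using h1
      · simpa [Function.update_of_ne h] using hsum i
    · intro i r
      by_cases h : i = j
      · subst h; simpa using h2 r
      · simpa [Function.update_of_ne h] using hnn i r
  have hfe : RelaxFeas xhat := by
    refine feas _ (by simp) fun r => ?_
    split_ifs <;> norm_num
  have hx := hc (xbar j)
  rw [Function.update_eq_self] at hx
  have hh : qsapF a B xhat = _ := hc (fun r => if r = s then 1 else 0)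
  set t := xbar j s with ht
  have hy := hc (fun r => (1 + t) * xbar j r - t * (if r = s then 1 else 0))
  have hle := hmin _ (feas (fun r => (1 + t) * xbar j r - t * (if r = s then 1 else 0))
    (by rw [sum_sub_distrib, ← mul_sum, ← mul_sum, hsum j]; simp)
    (by
      intro r
      split_ifs with h
      · subst h; rw [← ht]; nlinarith
      · have := hnn j r; simp only [mul_zero, sub_zero]; positivity))
  have hlin : ∑ r, c r * ((1 + t) * xbar j r - t * (if r = s then 1 else 0))
      = (1 + t) * (∑ r, c r * xbar j r) - t * ∑ r, c r * (if r = s then (1 : ℝ) else 0) := by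
    rw [mul_sum, mul_sum, ← sum_sub_distrib]
    exact sum_congr rfl fun r _ => by ring
  rw [hy, hlin, hx] at hle
  have h1 := hmin _ hfe
  have heq : qsapF a B xhat = qsapF a B xbar := by
    refine le_antisymm ?_ h1
    rw [hh, hx]
    have : t * (∑ r, c r * (if r = s then (1 : ℝ) else 0)) ≤ t * ∑ r, c r * xbar j r := by
      linarith
    have := le_of_mul_le_mul_left this hs
    linarith
  exact ⟨heq, hfe, fun y hy => heq ▸ hmin y hy⟩

end
end

section
/- Let x̄ be a global minimizer of the continuous relaxation problem, and for each block index i choose any index s_i with x̄^{(i)}_{s_i} > 0. Then the point x̂ defined by x̂^{(i)} = e_{s_i} (the standard unit vector in ℝ^{l_i}) for every i satisfies f(x̂) = f(x̄), is feasible for the CPD integer problem, and is a global minimizer of the CPD integer problem. In particular, the rounding procedure of Algorithm 1 applied to any global minimizer of the relaxation produces a global minimizer of the CPD integer problem. -/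
open Finset Filter

noncomputable section

def AffB {m : ℕ} (F : (Fin m → ℝ) → ℝ) : Prop :=
  ∃ (c : ℝ) (g : Fin m → ℝ), ∀ v, F v = c + ∑ r, g r * v r

theorem AffB.const {m : ℕ} (c : ℝ) : AffB (fun _ : Fin m → ℝ => c) :=
  ⟨c, 0, fun v => by simp⟩

theorem AffB.add {m : ℕ} {F G : (Fin m → ℝ) → ℝ} (hF : AffB F) (hG : AffB G) :
    AffB (fun v => F v + G v) := by
  obtain ⟨c, g, h⟩ := hF
  obtain ⟨d, k, h'⟩ := hG
  refine ⟨c + d, g + k, fun v => ?_⟩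
  simp only [h, h', Pi.add_apply, add_mul, Finset.sum_add_distrib]
  ring

theorem AffB.cmul {m : ℕ} {F : (Fin m → ℝ) → ℝ} (b : ℝ) (hF : AffB F) :
    AffB (fun v => b * F v) := by
  obtain ⟨c, g, h⟩ := hF
  refine ⟨b * c, fun r => b * g r, fun v => ?_⟩
  simp only [h, mul_add, Finset.mul_sum, mul_assoc]

theorem AffB.sum {m : ℕ} {ι : Type} (S : Finset ι) {F : ι → (Fin m → ℝ) → ℝ}
    (hF : ∀ i, AffB (F i)) : AffB (fun v => ∑ i ∈ S, F i v) := by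
  classical
  induction S using Finset.induction_on with
  | empty => simpa using AffB.const (m := m) 0
  | insert i S hi ih =>
    simp only [Finset.sum_insert hi]
    exact (hF i).add ih

theorem AffB.coord {n : ℕ} {l : Fin n → ℕ} (x : (i : Fin n) → Fin (l i) → ℝ) (k i : Fin n)
    (r : Fin (l i)) : AffB (fun v : Fin (l k) → ℝ => Function.update x k v i r) := by
  by_cases h : i = k
  · subst h
    refine ⟨0, fun q => if q = r then 1 else 0, fun v => ?_⟩
    simp
  · simp only [Function.update_of_ne h]
    exact AffB.const _

theorem qsapF_aff {n : ℕ} {l : Fin n → ℕ}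
    (a : (i : Fin n) → Fin (l i) → ℝ)
    (B : (i : Fin n) → (j : Fin n) → Matrix (Fin (l i)) (Fin (l j)) ℝ)
    (hdiag : ∀ i, B i i = 0) (x : (i : Fin n) → Fin (l i) → ℝ) (k : Fin n) :
    AffB (fun v : Fin (l k) → ℝ => qsapF a B (Function.update x k v)) := by
  unfold qsapF
  refine AffB.add (AffB.cmul _ (AffB.sum _ fun i => AffB.sum _ fun j => AffB.sum _ fun r =>
    AffB.sum _ fun s => ?_)) (AffB.sum _ fun i => AffB.sum _ fun r => AffB.cmul _ (AffB.coord ..))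
  by_cases hi : i = k
  · by_cases hj : j = k
    · subst hi
      subst hj
      simpa [hdiag] using AffB.const _
    · have := AffB.cmul (B i j r s * x j s) (AffB.coord x k i r)
      convert this using 2 with v
      rw [Function.update_of_ne hj]
      ring
  · have := AffB.cmul (B i j r s * x i r) (AffB.coord x k j s)
    convert this using 2 with v
    rw [Function.update_of_ne hi]

theorem round_step {n : ℕ} {l : Fin n → ℕ}
    (a : (i : Fin n) → Fin (l i) → ℝ)
    (B : (i : Fin n) → (j : Fin n) → Matrix (Fin (l i)) (Fin (l j)) ℝ)
    (hdiag : ∀ i, B i i = 0) (x : (i : Fin n) → Fin (l i) → ℝ) (hx : IsRelaxMin a B x)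
    (k : Fin n) (t : Fin (l k)) (ht : 0 < x k t) :
    IsRelaxMin a B (Function.update x k (fun r => if r = t then 1 else 0)) := by
  obtain ⟨⟨hsum, hnn⟩, hmin⟩ := hx
  obtain ⟨c, g, hg⟩ := qsapF_aff a B hdiag x k
  have feas : ∀ t : Fin (l k),
      RelaxFeas (Function.update x k (fun r => if r = t then (1:ℝ) else 0)) := by
    intro t
    constructor
    · intro i
      by_cases h : i = k
      · subst h
        simp
      · simp [Function.update_of_ne h, hsum]
    · intro i r
      by_cases h : i = k
      · subst h
        simp only [Function.update_self]
        split_ifs <;> norm_num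
      · simp [Function.update_of_ne h, hnn]
  have val : ∀ t : Fin (l k),
      qsapF a B (Function.update x k (fun r => if r = t then (1:ℝ) else 0)) = c + g t := by
    intro t
    have := hg (fun r => if r = t then (1:ℝ) else 0)
    simpa using this
  have hxv : qsapF a B x = c + ∑ r, g r * x k r := by
    have := hg (x k)
    simpa using this
  have hle : ∀ r, 0 ≤ x k r * (c + g r - qsapF a B x) := fun r =>
    mul_nonneg (hnn k r) (by have := hmin _ (feas r); rw [val] at this; linarith)
  have hz : ∑ r, x k r * (c + g r - qsapF a B x) = 0 := by
    have : ∀ r, x k r * (c + g r - qsapF a B x)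
        = (c - qsapF a B x) * x k r + g r * x k r := fun r => by ring
    simp only [this, Finset.sum_add_distrib, ← Finset.mul_sum, hsum]
    linarith
  have h0 := (Finset.sum_eq_zero_iff_of_nonneg (fun r _ => hle r)).1 hz t (Finset.mem_univ _)
  have h1 : c + g t - qsapF a B x = 0 := (mul_eq_zero.1 h0).resolve_left ht.ne'
  refine ⟨feas t, fun y hy => ?_⟩
  rw [val]
  linarith [hmin y hy]

/-- rounding a global minimizer `x̄` of the relaxation by picking,
in each block `i`, any index `s i` with `x̄^{(i)}_{s i} > 0` and setting that
entry to one (all other entries to zero) keeps the objective value and yields a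
feasible global minimizer of the CPD integer problem. -/
theorem stmt4 {n : ℕ} {l : Fin n → ℕ} (hn : 1 ≤ n) (hl : ∀ i, 1 ≤ l i)
    (a : (i : Fin n) → Fin (l i) → ℝ)
    (B : (i : Fin n) → (j : Fin n) → Matrix (Fin (l i)) (Fin (l j)) ℝ)
    (hsym : ∀ i j r s, B i j r s = B j i s r)
    (hdiag : ∀ i, B i i = 0)
    (xbar : (i : Fin n) → Fin (l i) → ℝ) (hxbar : IsRelaxMin a B xbar)
    (s : (i : Fin n) → Fin (l i)) (hs : ∀ i, 0 < xbar i (s i)) :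
    let xhat : (i : Fin n) → Fin (l i) → ℝ := fun i r => if r = s i then 1 else 0
    qsapF a B xhat = qsapF a B xbar ∧ IntFeas xhat ∧ IsIntMin a B xhat := by
  intro xhat
  have key : ∀ S : Finset (Fin n),
      IsRelaxMin a B (fun i => if i ∈ S then xhat i else xbar i) := by
    intro S
    induction S using Finset.induction_on with
    | empty => simpa using hxbar
    | insert k S hk ih =>
      have := round_step a B hdiag _ ih k (s k) (by simpa [hk] using hs k)
      convert this using 1
      funext i
      by_cases h : i = k
      · subst h
        simp [xhat]
      · simp [Function.update_of_ne h, h]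
  have hmin : IsRelaxMin a B xhat := by simpa using key Finset.univ
  have hint : IntFeas xhat := by
    refine ⟨fun i => by simp [xhat], fun i r => ?_⟩
    by_cases h : r = s i <;> simp [xhat, h]
  refine ⟨le_antisymm (hmin.2 _ hxbar.1) (hxbar.2 _ hmin.1), hint, hint, fun y hy => ?_⟩
  refine hmin.2 y ⟨hy.1, fun i r => ?_⟩
  rcases hy.2 i r with h | h <;> rw [h]
  norm_num

end
end

section
/- Suppose (x^k)_{k∈K} is a sequence of vectors in ℝ^m converging to z, where z is a global minimizer of the continuous relaxation problem. If ‖z‖₀ = n, then there exists an integer k₀ > 0 such that for all k ≥ k₀ with k ∈ K, the per-block argmax set J(x^k) equals the support Γ(z). -/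
open Finset Filter

noncomputable section

/-- if `(x^k)_{k ∈ K}` converges to a global minimizer `z` of the
relaxation with `‖z‖₀ = n`, then eventually (along `K`) the per-block argmax set
`J(x^k)` equals the support `Γ(z)`. -/
theorem stmt6 {n : ℕ} {l : Fin n → ℕ} (hn : 1 ≤ n) (hl : ∀ i, 1 ≤ l i)
    (a : (i : Fin n) → Fin (l i) → ℝ)
    (B : (i : Fin n) → (j : Fin n) → Matrix (Fin (l i)) (Fin (l j)) ℝ)
    (hsym : ∀ i j r s, B i j r s = B j i s r)
    (hdiag : ∀ i, B i i = 0)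
    (K : Set ℕ) (hK : K.Infinite)
    (x : ℕ → ((i : Fin n) → Fin (l i) → ℝ))
    (z : (i : Fin n) → Fin (l i) → ℝ)
    (hz : IsRelaxMin a B z)
    (hconv : Filter.Tendsto x (Filter.atTop ⊓ Filter.principal K) (nhds z))
    (hz0 : norm0 z = n) :
    ∃ k₀ : ℕ, 0 < k₀ ∧ ∀ k, k₀ ≤ k → k ∈ K → Jset (x k) = supp z := by
  classical
  obtain ⟨⟨hsum, hnn⟩, -⟩ := hz
  have hex : ∀ i, ∃ r, z i r ≠ 0 := by
    intro i
    by_contra h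
    push Not at h
    have := hsum i
    simp [h] at this
  choose g hg using hex
  let e : Fin n → (Σ i : Fin n, Fin (l i)) := fun i => ⟨i, g i⟩
  have he : Function.Injective e := fun i j h => congrArg Sigma.fst h
  have hsub : Set.range e ⊆ {p : Σ i : Fin n, Fin (l i) | z p.1 p.2 ≠ 0} := by
    rintro _ ⟨i, rfl⟩
    exact hg i
  have hcard : (Set.range e).ncard = n := by
    rw [← Set.image_univ, Set.ncard_image_of_injective _ he]
    simp
  have heq : Set.range e = {p : Σ i : Fin n, Fin (l i) | z p.1 p.2 ≠ 0} := by
    apply Set.eq_of_subset_of_ncard_le hsub _ (Set.toFinite _)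
    rw [hcard]
    exact hz0.le
  have hzero : ∀ i r, r ≠ g i → z i r = 0 := by
    intro i r hr
    by_contra h
    have : (⟨i, r⟩ : Σ i : Fin n, Fin (l i)) ∈ Set.range e := by
      rw [heq]
      exact h
    obtain ⟨j, hj⟩ := this
    have hji : j = i := congrArg Sigma.fst hj
    subst hji
    simp only [e, Sigma.mk.injEq, heq_eq_eq, true_and] at hj
    exact hr hj.symm
  have hpos : ∀ i, 0 < z i (g i) := fun i => lt_of_le_of_ne (hnn i _) (hg i).symm
  have hev : ∀ᶠ k in atTop ⊓ principal K, ∀ i, ∀ r, r ≠ g i → x k i r < x k i (g i) := by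
    rw [eventually_all]
    intro i
    rw [eventually_all]
    intro r
    by_cases hr : r = g i
    · simp [hr]
    · have h1 := tendsto_pi_nhds.1 (tendsto_pi_nhds.1 hconv i)
      have h2 := (h1 r).eventually_lt (h1 (g i)) (by rw [hzero i r hr]; exact hpos i)
      filter_upwards [h2] with k hk _
      exact hk
  rw [eventually_inf_principal, eventually_atTop] at hev
  obtain ⟨N, hN⟩ := hev
  refine ⟨N + 1, Nat.succ_pos _, fun k hk hkK => ?_⟩
  have hx := hN k (by omega) hkK
  ext ⟨i, r⟩
  simp only [Jset, supp, Set.mem_setOf_eq]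
  constructor
  · intro h
    by_cases hr : r = g i
    · rw [hr]
      exact hpos i
    · exact absurd (h (g i)) (not_le.2 (hx i r hr))
  · intro h r'
    have hr : r = g i := by
      by_contra hr
      exact h.ne' (hzero i r hr)
    subst hr
    by_cases hr' : r' = g i
    · rw [hr']
    · exact (hx i r' hr').le

end
end

section
/- Suppose (x^k)_{k∈K} is a sequence of vectors in ℝ^m converging to z, where z is a global minimizer of the continuous relaxation problem. If there exists a positive integer k₀ such that ‖x^k‖₀ = n for all k ≥ k₀ with k ∈ K, then z is a global minimizer of the CPD integer problem, and there exists a positive integer k₁ ≥ k₀ such that the support Γ(x^k) equals the support Γ(z) for all k ≥ k₁ with k ∈ K. -/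
open Finset Filter

noncomputable section

/-- if `(x^k)_{k ∈ K}` converges to a global minimizer `z` of the
relaxation and `‖x^k‖₀ = n` for all `k ≥ k₀`, `k ∈ K`, then `z` globally solves
the integer problem and `Γ(x^k) = Γ(z)` for all large `k ∈ K`. -/
theorem stmt9 {n : ℕ} {l : Fin n → ℕ} (hn : 1 ≤ n) (hl : ∀ i, 1 ≤ l i)
    (a : (i : Fin n) → Fin (l i) → ℝ)
    (B : (i : Fin n) → (j : Fin n) → Matrix (Fin (l i)) (Fin (l j)) ℝ)
    (hsym : ∀ i j r s, B i j r s = B j i s r)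
    (hdiag : ∀ i, B i i = 0)
    (K : Set ℕ) (hK : K.Infinite)
    (x : ℕ → ((i : Fin n) → Fin (l i) → ℝ))
    (z : (i : Fin n) → Fin (l i) → ℝ)
    (hz : IsRelaxMin a B z)
    (hconv : Filter.Tendsto x (Filter.atTop ⊓ Filter.principal K) (nhds z))
    (k₀ : ℕ) (hk₀ : 0 < k₀)
    (hsupp : ∀ k, k₀ ≤ k → k ∈ K → norm0 (x k) = n) :
    IsIntMin a B z ∧
    ∃ k₁ : ℕ, k₀ ≤ k₁ ∧ ∀ k, k₁ ≤ k → k ∈ K → supp (x k) = supp z := by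
  classical
  obtain ⟨⟨hsum, hnn⟩, hmin⟩ := hz
  have hex : ∀ i, ∃ r, 0 < z i r := by
    intro i
    by_contra hcon
    push Not at hcon
    have h1 : ∑ r, z i r ≤ 0 := Finset.sum_nonpos (fun r _ => hcon r)
    rw [hsum i] at h1
    linarith
  choose r hr using hex
  let g : Fin n → Σ i : Fin n, Fin (l i) := fun i => ⟨i, r i⟩
  have hg : Function.Injective g := by
    intro i j h
    exact congrArg Sigma.fst h
  have hcard : (Set.range g).ncard = n := by
    rw [← Set.image_univ, Set.ncard_image_of_injective _ hg, Set.ncard_univ, Nat.card_fin]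
  have hSz : Set.range g ⊆ supp z := by
    rintro _ ⟨i, rfl⟩
    exact hr i
  have hev : ∀ᶠ k in Filter.atTop ⊓ Filter.principal K,
      ∀ p : Σ i : Fin n, Fin (l i), 0 < z p.1 p.2 → 0 < x k p.1 p.2 := by
    rw [Filter.eventually_all]
    intro p
    by_cases hp : 0 < z p.1 p.2
    · have h1 := tendsto_pi_nhds.1 (tendsto_pi_nhds.1 hconv p.1) p.2
      filter_upwards [h1.eventually (lt_mem_nhds hp)] with k hk _
      exact hk
    · exact Filter.Eventually.of_forall (fun k h => absurd h hp)
  rw [Filter.eventually_inf_principal, Filter.eventually_atTop] at hev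
  obtain ⟨N, hN⟩ := hev
  have key : ∀ k, max k₀ N ≤ k → k ∈ K → supp z = Set.range g ∧ supp (x k) = supp z := by
    intro k hk hkK
    have hpos := hN k (le_trans (le_max_right _ _) hk) hkK
    have hc := hsupp k (le_trans (le_max_left _ _) hk) hkK
    have hzx : supp z ⊆ supp (x k) := fun p hp => hpos p hp
    have hxn : supp (x k) ⊆ {p : Σ i : Fin n, Fin (l i) | x k p.1 p.2 ≠ 0} :=
      fun p hp => ne_of_gt hp
    have heq : Set.range g = {p : Σ i : Fin n, Fin (l i) | x k p.1 p.2 ≠ 0} := by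
      apply Set.eq_of_subset_of_ncard_le (hSz.trans (hzx.trans hxn))
      · rw [hcard]
        exact le_of_eq hc
    rw [← heq] at hxn
    exact ⟨Set.Subset.antisymm (hzx.trans hxn) hSz,
      Set.Subset.antisymm (hxn.trans hSz) hzx⟩
  refine ⟨?_, max k₀ N, le_max_left _ _, fun k hk hkK => (key k hk hkK).2⟩
  obtain ⟨k, hkK, hk⟩ := hK.exists_gt (max k₀ N)
  have hs := (key k hk.le hkK).1
  have hzero : ∀ i s, s ≠ r i → z i s = 0 := by
    intro i s hne
    by_contra h0
    have hp : (⟨i, s⟩ : Σ i : Fin n, Fin (l i)) ∈ supp z :=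
      lt_of_le_of_ne (hnn i s) (Ne.symm h0)
    rw [hs] at hp
    obtain ⟨j, hj⟩ := hp
    obtain rfl : j = i := congrArg Sigma.fst hj
    exact hne (eq_of_heq (Sigma.mk.inj hj).2).symm
  refine ⟨⟨hsum, ?_⟩, ?_⟩
  · intro i s
    by_cases h : s = r i
    · right
      rw [h, ← hsum i]
      exact (Finset.sum_eq_single (r i) (fun b _ hb => hzero i b hb) (by simp)).symm
    · exact Or.inl (hzero i s h)
  · intro y hy
    apply hmin y ⟨hy.1, ?_⟩
    intro i s
    rcases hy.2 i s with h | h <;> rw [h]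
    exact zero_le_one

end
end

section
/- If z is a global minimizer of the continuous relaxation problem with ‖z‖₀ = n, then each block z^{(i)} has exactly one nonzero entry, that entry equals 1 (so all entries of z lie in {0,1}), and z is a global minimizer of the CPD integer problem. -/
open Finset Filter

noncomputable section

/-- a global minimizer `z` of the relaxation with `‖z‖₀ = n` has
exactly one nonzero entry per block, every entry of `z` lies in {0,1} (so the
nonzero entry equals 1), and `z` globally solves the integer problem. -/
theorem stmt10 {n : ℕ} {l : Fin n → ℕ} (hn : 1 ≤ n) (hl : ∀ i, 1 ≤ l i)
    (a : (i : Fin n) → Fin (l i) → ℝ)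
    (B : (i : Fin n) → (j : Fin n) → Matrix (Fin (l i)) (Fin (l j)) ℝ)
    (hsym : ∀ i j r s, B i j r s = B j i s r)
    (hdiag : ∀ i, B i i = 0)
    (z : (i : Fin n) → Fin (l i) → ℝ)
    (hz : IsRelaxMin a B z)
    (hz0 : norm0 z = n) :
    (∀ i, ∃! r, z i r ≠ 0) ∧
    (∀ i r, z i r ≠ 0 → z i r = 1) ∧
    (∀ i r, z i r = 0 ∨ z i r = 1) ∧
    IsIntMin a B z := by
  obtain ⟨⟨hsum, hnn⟩, hmin⟩ := hz
  have hex : ∀ i, ∃ r, z i r ≠ 0 := by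
    intro i
    by_contra! h
    have := hsum i
    simp [h] at this
  choose g hg using hex
  have hsub : Set.range (fun i => (⟨i, g i⟩ : Σ i : Fin n, Fin (l i))) ⊆
      {p : Σ i : Fin n, Fin (l i) | z p.1 p.2 ≠ 0} := by
    rintro _ ⟨i, rfl⟩
    exact hg i
  have hcard : Set.ncard (Set.range (fun i => (⟨i, g i⟩ : Σ i : Fin n, Fin (l i)))) = n := by
    rw [← Set.image_univ, Set.ncard_image_of_injective]
    · simp
    · intro i j h
      exact congrArg Sigma.fst h
  have heq := Set.eq_of_subset_of_ncard_le hsub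
    (by rw [hcard]; exact hz0.le) (Set.toFinite _)
  have huniq : ∀ i r, z i r ≠ 0 → r = g i := by
    intro i r h
    have hm : (⟨i, r⟩ : Σ i : Fin n, Fin (l i)) ∈
        {p : Σ i : Fin n, Fin (l i) | z p.1 p.2 ≠ 0} := h
    rw [← heq] at hm
    obtain ⟨j, hj⟩ := hm
    cases hj
    rfl
  have hone : ∀ i, z i (g i) = 1 := by
    intro i
    rw [← hsum i]
    symm
    apply Finset.sum_eq_single
    · intro r _ hr
      by_contra h
      exact hr (huniq i r h)
    · simp
  have h1 : ∀ i r, z i r ≠ 0 → z i r = 1 := by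
    intro i r h
    rw [huniq i r h]
    exact hone i
  have h01 : ∀ i r, z i r = 0 ∨ z i r = 1 := fun i r => by
    by_cases h : z i r = 0
    · exact Or.inl h
    · exact Or.inr (h1 i r h)
  refine ⟨fun i => ⟨g i, hg i, fun r h => huniq i r h⟩, h1, h01, ⟨hsum, h01⟩, ?_⟩
  rintro y ⟨hy, hy01⟩
  refine hmin y ⟨hy, fun i r => ?_⟩
  rcases hy01 i r with h | h <;> simp [h]


end
end
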